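/- arXiv:2003.00815 — 2 statements merged into one kernel-verified Lean document; each statement's English description precedes it below -/
import Mathlib

section
/- For every integer n ≥ 4, one has t(1, n) ≥ 2q + 1. -/
open Polynomial Matrix

noncomputable section

namespace SturmFF

variable (Fq : Type) [Field Fq] [Fintype Fq]

/-- The local field `K_∞ = 𝔽_q((π_∞))`. -/
abbrev Kinf := LaurentSeries Fq

/-- The uniformizer `π_∞`. -/
def piInf : Kinf Fq := HahnSeries.single 1 1

/-- The element `θ = π_∞⁻¹` of `K_∞`. -/
def thetaK : Kinf Fq := HahnSeries.single (-1) 1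

/-- The embedding `A = 𝔽_q[θ] → K_∞` sending `θ` to `π_∞⁻¹`. -/
def polyToK : Polynomial Fq →+* Kinf Fq := (Polynomial.aeval (thetaK Fq)).toRingHom

/-- Membership in the valuation ring `O_∞ = 𝔽_q[[π_∞]]`. -/
def memO (x : Kinf Fq) : Prop := ∀ n : ℤ, n < 0 → x.coeff n = 0

/-- A matrix has all entries in `O_∞`. -/
def MatO (κ : Matrix (Fin 2) (Fin 2) (Kinf Fq)) : Prop := ∀ i j, memO Fq (κ i j)

/-- Membership in `GL₂(O_∞)`: entries in `O_∞` and determinant a unit of `O_∞`. -/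
def InGLO (κ : Matrix (Fin 2) (Fin 2) (Kinf Fq)) : Prop :=
  MatO Fq κ ∧ κ.det.coeff 0 ≠ 0

/-- Membership in the Iwahori subgroup `I_∞ ⊆ GL₂(O_∞)`. -/
def InIw (κ : Matrix (Fin 2) (Fin 2) (Kinf Fq)) : Prop :=
  InGLO Fq κ ∧ ∀ n : ℤ, n < 1 → (κ 1 0).coeff n = 0

/-- The matrix `diag(θ^r, 1)`. -/
def Dmat (r : ℕ) : Matrix (Fin 2) (Fin 2) (Kinf Fq) := !![thetaK Fq ^ r, 0; 0, 1]

/-- The matrix `(0, 1; π_∞, 0)`. -/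
def Jmat : Matrix (Fin 2) (Fin 2) (Kinf Fq) := !![0, 1; piInf Fq, 0]

/-- The Atkin–Lehner/Fricke matrix `w_𝔫 = (0, -1; 𝔫, 0)`. -/
def wmat (𝔫 : Polynomial Fq) : Matrix (Fin 2) (Fin 2) (Kinf Fq) :=
  !![0, -1; polyToK Fq 𝔫, 0]

/-- Membership in the Hecke congruence subgroup `Γ₀(𝔫) ⊆ GL₂(A)`. -/
def InGamma0 (𝔫 : Polynomial Fq) (γ : Matrix (Fin 2) (Fin 2) (Polynomial Fq)) : Prop :=
  IsUnit γ.det ∧ 𝔫 ∣ γ 1 0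

/-- A `Γ₀(𝔫)`-invariant harmonic cochain, viewed as a function on `GL₂(K_∞)`
(encoded as a function on all matrices, with the conditions imposed on invertible ones). -/
def Harmonic (𝔫 : Polynomial Fq) (f : Matrix (Fin 2) (Fin 2) (Kinf Fq) → ℂ) : Prop :=
  (∀ g : Matrix (Fin 2) (Fin 2) (Kinf Fq), g.det ≠ 0 →
    ∀ γ : Matrix (Fin 2) (Fin 2) (Polynomial Fq), InGamma0 Fq 𝔫 γ →
    ∀ z : Kinf Fq, z ≠ 0 → ∀ κ : Matrix (Fin 2) (Fin 2) (Kinf Fq), InIw Fq κ →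
      f (γ.map (polyToK Fq) * g * (z • (1 : Matrix (Fin 2) (Fin 2) (Kinf Fq))) * κ) = f g)
  ∧ (∀ g : Matrix (Fin 2) (Fin 2) (Kinf Fq), g.det ≠ 0 → f (g * Jmat Fq) = - f g)
  ∧ (∀ g : Matrix (Fin 2) (Fin 2) (Kinf Fq), g.det ≠ 0 →
      (∑ ε : Fq, f (g * !![1, 0; polyToK Fq (Polynomial.C ε), 1])) + f (g * !![0, 1; 1, 0]) = 0)

/-- A harmonic cochain is cuspidal if it is finitely supported modulo
`Γ₀(𝔫)` on the left and `K_∞^× I_∞` on the right. -/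
def Cuspidal (𝔫 : Polynomial Fq) (f : Matrix (Fin 2) (Fin 2) (Kinf Fq) → ℂ) : Prop :=
  ∃ S : Finset (Matrix (Fin 2) (Fin 2) (Kinf Fq)),
    ∀ g : Matrix (Fin 2) (Fin 2) (Kinf Fq), g.det ≠ 0 → f g ≠ 0 →
      ∃ s ∈ S, ∃ γ : Matrix (Fin 2) (Fin 2) (Polynomial Fq), InGamma0 Fq 𝔫 γ ∧
        ∃ z : Kinf Fq, z ≠ 0 ∧ ∃ κ : Matrix (Fin 2) (Fin 2) (Kinf Fq), InIw Fq κ ∧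
          g = γ.map (polyToK Fq) * s * (z • (1 : Matrix (Fin 2) (Fin 2) (Kinf Fq))) * κ

/-- The additive character `ψ` of `K_∞`. -/
def psi (x : Kinf Fq) : ℂ :=
  letI := ZMod.algebra Fq (ringChar Fq)
  Complex.exp (2 * Real.pi * Complex.I *
    ((Algebra.trace (ZMod (ringChar Fq)) Fq (x.coeff 1)).val : ℂ) / (ringChar Fq : ℂ))

/-- The constant Fourier coefficient `c₀(f)`. -/
def c0 (f : Matrix (Fin 2) (Fin 2) (Kinf Fq) → ℂ) : ℂ :=
  (Fintype.card Fq : ℂ)⁻¹ *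
    ∑ c : Fq, f !![piInf Fq ^ 2, polyToK Fq (Polynomial.C c) * piInf Fq; 0, 1]

/-- The element `u = Σ_{i=1}^{d+1} c_i π_∞^i` of `K_∞` attached to a tuple of coefficients. -/
def uOf (d : ℕ) (c : Fin (d + 1) → Fq) : Kinf Fq :=
  ∑ i : Fin (d + 1), HahnSeries.single ((i : ℤ) + 1) (c i)

/-- The Fourier coefficient `c_𝔪(f)` for a monic polynomial `𝔪`. -/
def cm (𝔪 : Polynomial Fq) (f : Matrix (Fin 2) (Fin 2) (Kinf Fq) → ℂ) : ℂ :=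
  (Fintype.card Fq : ℂ)⁻¹ *
    ∑ c : Fin (𝔪.natDegree + 1) → Fq,
      f !![piInf Fq ^ (𝔪.natDegree + 2), uOf Fq 𝔪.natDegree c; 0, 1] *
        psi Fq (-(polyToK Fq 𝔪 * uOf Fq 𝔪.natDegree c))

/-- `δ_𝔫(c,d)`: the least `m` such that some `x, y` of degree at most `m`
satisfy `gcd(cx + dy, 𝔫) = 1`. -/
def deltaN (𝔫 c d : Polynomial Fq) : ℕ :=
  sInf { m : ℕ | ∃ x y : Polynomial Fq, x.degree ≤ (m : WithBot ℕ) ∧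
    y.degree ≤ (m : WithBot ℕ) ∧ IsCoprime (c * x + d * y) 𝔫 }

open Classical in
/-- `ε_𝔫(c,d) ∈ {0,1}`. -/
def epsN (𝔫 c d : Polynomial Fq) : ℕ :=
  if ∃ x₀ y₀ : Polynomial Fq, y₀.degree < x₀.degree ∧
      x₀.degree = (deltaN Fq 𝔫 c d : WithBot ℕ) ∧ IsCoprime (c * x₀ + d * y₀) 𝔫
  then 0 else 1

/-- The set `S(c,d;m)`. -/
def Sset (c d : Polynomial Fq) (m : ℕ) : Set (Polynomial Fq) :=
  { z | ∃ x y : Polynomial Fq, x.degree ≤ (m : WithBot ℕ) ∧ y.degree ≤ (m : WithBot ℕ) ∧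
      z = x * c + y * d }

/-- `t(c,d;m)`: the largest cardinality of a pairwise-coprime subset of `S(c,d;m)`. -/
def tcd (c d : Polynomial Fq) (m : ℕ) : ℕ :=
  sSup { n : ℕ | ∃ S' : Finset (Polynomial Fq), ↑S' ⊆ Sset Fq c d m ∧
    (∀ a ∈ S', ∀ b ∈ S', a ≠ b → IsCoprime a b) ∧ S'.card = n }

/-- `t(m,n) ∈ ℕ∞`. -/
def tmn (m n : ℕ) : ℕ∞ :=
  sInf { k : ℕ∞ | ∃ c d : Polynomial Fq, IsCoprime c d ∧
    ((m : WithBot ℕ) + 1) < max c.degree d.degree ∧ max c.degree d.degree < (n : WithBot ℕ) ∧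
    k = (tcd Fq c d m : ℕ∞) }

/-- `t(𝔫)`: the number of distinct monic prime factors of `𝔫`. -/
def tPrimes (𝔫 : Polynomial Fq) : ℕ :=
  Set.ncard { p : Polynomial Fq | p.Monic ∧ Irreducible p ∧ p ∣ 𝔫 }

/-- `τ(𝔫)`. -/
def tauN (𝔫 : Polynomial Fq) : ℕ :=
  sInf { m : ℕ | (tPrimes Fq 𝔫 : ℕ∞) < tmn Fq m 𝔫.natDegree }

/-- There are `2q` affine functions `a ↦ s * a + t` on a field with `q > 2` elements such that no
two of them meet the graph of a given function in the same point outside `a = 0`. -/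
lemma exists_affine_family {F : Type*} [Field F] [Fintype F] (hq : 2 < Fintype.card F)
    (p : F → F) :
    ∃ L : Finset (F × F), 2 * Fintype.card F ≤ L.card ∧
      ∀ l ∈ L, ∀ l' ∈ L, l ≠ l' → ∀ a : F, a ≠ 0 →
        ¬ (l.1 * a + l.2 = p a ∧ l'.1 * a + l'.2 = p a) := by
  classical
  obtain ⟨b, hb0, hb1⟩ : ∃ b : F, b ≠ 0 ∧ b ≠ 1 := by
    have h : ({0, 1} : Finset F).card < Finset.univ.card :=
      lt_of_le_of_lt Finset.card_le_two (by simpa using hq)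
    obtain ⟨b, -, hb⟩ := Finset.exists_mem_notMem_of_card_lt_card h
    exact ⟨b, by simpa [not_or] using hb⟩
  have hb1' : b - 1 ≠ 0 := sub_ne_zero.mpr hb1
  let s₁ : F := (p b - p 1) / (b - 1)
  let s₀ : F := s₁ + 1
  have hs : s₁ ≠ s₀ := by simp [s₀]
  let D : Finset F := Finset.univ.erase 0
  have hD : D.card = Fintype.card F - 1 := by simp [D]
  let hit : F → Finset F := fun s => D.image fun a => p a - s * a
  have hit_le : ∀ s, (hit s).card ≤ Fintype.card F - 1 := fun s =>
    hD ▸ Finset.card_image_le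
  have hit_lt : (hit s₁).card < Fintype.card F - 1 := by
    rw [← hD]
    refine lt_of_le_of_ne Finset.card_image_le fun h => hb1 ?_
    refine Finset.card_image_iff.mp h (by simp [D, hb0]) (by simp [D]) ?_
    simp only [s₁]
    field_simp
    ring
  let M : F → Finset F := fun s => if s = s₀ then Finset.univ else (hit s)ᶜ
  refine ⟨Finset.univ.filter fun l => l.2 ∈ M l.1, ?_, ?_⟩
  · have hcard : (Finset.univ.filter fun l : F × F => l.2 ∈ M l.1).card = ∑ s, (M s).card := by
      rw [Finset.card_filter, Fintype.sum_prod_type]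
      refine Finset.sum_congr rfl fun s _ => ?_
      simp
    have hM : ∀ s, 1 + (if s = s₀ then Fintype.card F - 1 else 0) + (if s = s₁ then 1 else 0)
        ≤ (M s).card := by
      intro s
      by_cases h0 : s = s₀
      · have h1 : s ≠ s₁ := fun h => hs (h.symm.trans h0)
        simp only [M, h0, if_true, Finset.card_univ, if_neg (Ne.symm hs)]
        omega
      · simp only [M, if_neg h0, Finset.card_compl]
        split_ifs with h1
        · rw [h1]; omega
        · have := hit_le s
          omega
    have hsum := Finset.sum_le_sum fun s (_ : s ∈ Finset.univ) => hM s
    rw [← hcard] at hsum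
    simp only [Finset.sum_add_distrib, Finset.sum_ite_eq', Finset.mem_univ, if_true,
      Finset.sum_const, Finset.card_univ, smul_eq_mul] at hsum
    omega
  · rintro ⟨s, t⟩ hl ⟨s', t'⟩ hl' hne a ha ⟨h, h'⟩
    simp only [Finset.mem_filter, Finset.mem_univ, true_and] at hl hl' h h'
    have key : ∀ s t : F, t ∈ M s → s * a + t = p a → s = s₀ := by
      intro s t hm hst
      by_contra hs0
      simp only [M, if_neg hs0, Finset.mem_compl, hit] at hm
      exact hm (Finset.mem_image.mpr ⟨a, by simp [D, ha], by rw [← hst]; ring⟩)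
    have e := key s t hl h
    have e' := key s' t' hl' h'
    subst e
    subst e'
    exact hne (by rw [add_left_cancel (h.trans h'.symm)])

lemma isCoprime_X_sub_C_iff {F : Type*} [Field F] {a : F} {f : Polynomial F} :
    IsCoprime (X - C a) f ↔ f.eval a ≠ 0 := by
  rw [(irreducible_X_sub_C a).coprime_iff_not_dvd, dvd_iff_isRoot, IsRoot.def]

lemma not_eval_zero_of_isCoprime {F : Type*} [Field F] {c d : Polynomial F} (h : IsCoprime c d)
    {a : F} (hd : d.eval a = 0) : c.eval a ≠ 0 := by
  obtain ⟨u, v, huv⟩ := h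
  intro hc
  simpa [hc, hd] using congrArg (eval a) huv

section PairwiseCoprime

variable {F : Type} [Field F]

/-- The map `(x, y) ↦ x * c + y * d` is injective on pairs of polynomials of degree at most one. -/
def LinearlyFree (c d : Polynomial F) : Prop :=
  ∀ x y : Polynomial F, x.degree ≤ 1 → y.degree ≤ 1 → x * c + y * d = 0 → x = 0 ∧ y = 0

lemma LinearlyFree.swap {c d : Polynomial F} (h : LinearlyFree c d) : LinearlyFree d c :=
  fun x y hx hy hxy => (h y x hy hx (by rw [← hxy]; ring)).symm

lemma degree_C_mul_add_le {x y : Polynomial F} (k : F) (hx : x.degree ≤ 1) (hy : y.degree ≤ 1) :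
    (C k * x + y).degree ≤ 1 :=
  (degree_add_le _ _).trans (max_le ((smul_eq_C_mul (p := x) k ▸ degree_smul_le k x).trans hx) hy)

lemma LinearlyFree.shear {c d : Polynomial F} (h : LinearlyFree c d) (k : F) :
    LinearlyFree (c + C k * d) d := by
  intro x y hx hy hxy
  obtain ⟨rfl, h2⟩ := h x (C k * x + y) hx (degree_C_mul_add_le k hx hy) (by rw [← hxy]; ring)
  exact ⟨rfl, by simpa using h2⟩

lemma linearlyFree_of_degree_left {c d : Polynomial F} (h : IsCoprime c d) (hc : 1 < c.degree) :
    LinearlyFree c d := by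
  intro x y hx hy hxy
  have hdvd : c ∣ y * d := ⟨-x, by linear_combination hxy⟩
  have hy0 : y = 0 := eq_zero_of_dvd_of_degree_lt (h.dvd_of_dvd_mul_right hdvd) (hy.trans_lt hc)
  subst hy0
  have hc0 : c ≠ 0 := by
    rintro rfl
    simp at hc
  exact ⟨by simpa [hc0] using hxy, rfl⟩

lemma linearlyFree_of_degree_max {c d : Polynomial F} (h : IsCoprime c d)
    (hm : 1 < max c.degree d.degree) : LinearlyFree c d := by
  rcases lt_max_iff.mp hm with hc | hd
  · exact linearlyFree_of_degree_left h hc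
  · exact (linearlyFree_of_degree_left h.symm hd).swap

/-- `S(c,d;1)` contains a pairwise coprime subset with at least `N` elements. -/
def HasCoprimeSubset (c d : Polynomial F) (N : ℕ) : Prop :=
  ∃ S : Finset (Polynomial F), ↑S ⊆ Sset F c d 1 ∧
    (∀ a ∈ S, ∀ b ∈ S, a ≠ b → IsCoprime a b) ∧ N ≤ S.card

lemma HasCoprimeSubset.mono {c d c' d' : Polynomial F} {N : ℕ} (h : HasCoprimeSubset c d N)
    (hS : Sset F c d 1 ⊆ Sset F c' d' 1) : HasCoprimeSubset c' d' N :=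
  let ⟨S, h1, h2⟩ := h
  ⟨S, h1.trans hS, h2⟩

lemma HasCoprimeSubset.swap {c d : Polynomial F} {N : ℕ} (h : HasCoprimeSubset d c N) :
    HasCoprimeSubset c d N :=
  h.mono fun _ ⟨x, y, hx, hy, hz⟩ => ⟨y, x, hy, hx, by rw [hz]; ring⟩

lemma HasCoprimeSubset.of_shear {c d : Polynomial F} {N : ℕ} (k : F)
    (h : HasCoprimeSubset (c + C k * d) d N) : HasCoprimeSubset c d N :=
  h.mono fun _ ⟨x, y, hx, hy, hz⟩ =>
    ⟨x, C k * x + y, hx, degree_C_mul_add_le k hx hy, by rw [hz]; ring⟩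

lemma LinearlyFree.hasCoprimeSubset {c d : Polynomial F} (h : LinearlyFree c d)
    (W : Finset (Polynomial F × Polynomial F))
    (hW : ∀ w ∈ W, w.1.degree ≤ 1 ∧ w.2.degree ≤ 1)
    (hco : ∀ w ∈ W, ∀ w' ∈ W, w ≠ w' →
      IsCoprime (w.1 * c + w.2 * d) (w'.1 * c + w'.2 * d)) :
    HasCoprimeSubset c d W.card := by
  classical
  refine ⟨W.image fun w => w.1 * c + w.2 * d, ?_, ?_, ?_⟩
  · intro z hz
    obtain ⟨w, hw, rfl⟩ := Finset.mem_image.mp (Finset.mem_coe.mp hz)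
    exact ⟨w.1, w.2, (hW w hw).1, (hW w hw).2, rfl⟩
  · intro a ha b hb hab
    obtain ⟨w, hw, rfl⟩ := Finset.mem_image.mp ha
    obtain ⟨w', hw', rfl⟩ := Finset.mem_image.mp hb
    exact hco w hw w' hw' fun e => hab (by rw [e])
  · rw [Finset.card_image_of_injOn]
    intro w hw w' hw' e
    have e' : w.1 * c + w.2 * d = w'.1 * c + w'.2 * d := e
    obtain ⟨h1, h2⟩ := h (w.1 - w'.1) (w.2 - w'.2)
      ((degree_sub_le _ _).trans (max_le (hW w hw).1 (hW w' hw').1))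
      ((degree_sub_le _ _).trans (max_le (hW w hw).2 (hW w' hw').2))
      (by linear_combination e')
    exact Prod.ext (sub_eq_zero.mp h1) (sub_eq_zero.mp h2)

/-- Two elements `c + ℓ * d` with `ℓ` affine are coprime once they have no common root. -/
lemma isCoprime_add_linear_mul {c d : Polynomial F} (h : IsCoprime c d) {l l' : F × F}
    (hne : l ≠ l')
    (hroot : ∀ a, ¬ (c.eval a + (l.1 * a + l.2) * d.eval a = 0 ∧
      c.eval a + (l'.1 * a + l'.2) * d.eval a = 0)) :
    IsCoprime (c + (C l.1 * X + C l.2) * d) (c + (C l'.1 * X + C l'.2) * d) := by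
  obtain ⟨s, t⟩ := l
  obtain ⟨s', t'⟩ := l'
  dsimp only at hroot ⊢
  set f := c + (C s * X + C t) * d with hf
  have hfd : IsCoprime f d := h.add_mul_right_left _
  suffices hl : IsCoprime f (C (s' - s) * X + C (t' - t)) by
    have e : c + (C s' * X + C t') * d = (C (s' - s) * X + C (t' - t)) * d + f * 1 := by
      rw [hf, C_sub, C_sub]
      ring
    rw [e]
    exact (hl.mul_right hfd).add_mul_left_right 1
  by_cases hs : s' = s
  · have ht : t' - t ≠ 0 := fun e => hne (by rw [hs, sub_eq_zero.mp e])
    subst hs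
    simpa using isCoprime_one_right.of_isCoprime_of_dvd_right (isUnit_C.mpr ht.isUnit).dvd
  · have hs' : s' - s ≠ 0 := sub_ne_zero.mpr hs
    have hfac : C (s' - s) * X + C (t' - t) =
        C (s' - s) * (X - C (-(t' - t) / (s' - s))) := by
      rw [mul_sub, ← C_mul, mul_div_cancel₀ _ hs', C_neg]
      ring
    rw [hfac]
    refine IsCoprime.mul_right
      (isCoprime_one_right.of_isCoprime_of_dvd_right (isUnit_C.mpr hs'.isUnit).dvd)
      (isCoprime_X_sub_C_iff.mpr fun h0 => ?_).symm
    set a := -(t' - t) / (s' - s) with ha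
    have hst : s * a + t = s' * a + t' := by
      rw [ha]
      field_simp
      ring
    have h1 : c.eval a + (s * a + t) * d.eval a = 0 := by simpa [hf] using h0
    exact hroot a ⟨h1, by rw [← hst]; exact h1⟩

lemma degree_linear_le_one (s t : F) : (C s * X + C t).degree ≤ 1 := degree_linear_le

lemma hasCoprimeSubset_of_affine_family {c d : Polynomial F} (h : IsCoprime c d)
    (hf : LinearlyFree c d) (L : Finset (F × F))
    (hL : ∀ l ∈ L, ∀ l' ∈ L, l ≠ l' → ∀ a,
      ¬ (c.eval a + (l.1 * a + l.2) * d.eval a = 0 ∧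
        c.eval a + (l'.1 * a + l'.2) * d.eval a = 0)) :
    HasCoprimeSubset c d (L.card + 1) := by
  classical
  let g : F × F → Polynomial F × Polynomial F := fun l => (1, C l.1 * X + C l.2)
  have hg : Function.Injective g := by
    rintro ⟨s, t⟩ ⟨s', t'⟩ e
    have e2 : C s * X + C t = C s' * X + C t' := (Prod.ext_iff.mp e).2
    have h0 := congrArg (fun f => coeff f 0) e2
    have h1 := congrArg (fun f => coeff f 1) e2
    simp [coeff_C] at h0 h1
    rw [h0, h1]
  have hnot : ((0, 1) : Polynomial F × Polynomial F) ∉ L.image g := by simp [g]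
  have hco : ∀ l : F × F, IsCoprime (c + (C l.1 * X + C l.2) * d) d := fun l =>
    h.add_mul_right_left _
  rw [← Finset.card_image_of_injective L hg, ← Finset.card_insert_of_notMem hnot]
  refine hf.hasCoprimeSubset _ ?_ ?_
  · intro w hw
    rcases Finset.mem_insert.mp hw with rfl | hw
    · simp
    · obtain ⟨l, -, rfl⟩ := Finset.mem_image.mp hw
      exact ⟨by simp [g], degree_linear_le_one _ _⟩
  · intro w hw w' hw' hne
    rcases Finset.mem_insert.mp hw with rfl | hw <;>
      rcases Finset.mem_insert.mp hw' with rfl | hw'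
    · exact absurd rfl hne
    · obtain ⟨l, -, rfl⟩ := Finset.mem_image.mp hw'
      simpa [g] using (hco l).symm
    · obtain ⟨l, -, rfl⟩ := Finset.mem_image.mp hw
      simpa [g] using hco l
    · obtain ⟨l, hl, rfl⟩ := Finset.mem_image.mp hw
      obtain ⟨l', hl', rfl⟩ := Finset.mem_image.mp hw'
      have hll : l ≠ l' := fun e => hne (by rw [e])
      simpa [g] using isCoprime_add_linear_mul h hll (hL l hl l' hl' hll)

lemma HasCoprimeSubset.of_le {c d : Polynomial F} {M N : ℕ} (h : HasCoprimeSubset c d N)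
    (hMN : M ≤ N) : HasCoprimeSubset c d M :=
  let ⟨S, h1, h2, h3⟩ := h
  ⟨S, h1, h2, hMN.trans h3⟩

lemma hasCoprimeSubset_five {c d : Polynomial F} (h : IsCoprime c d) (hf : LinearlyFree c d)
    (h0 : c.eval 0 ≠ 0) (h1 : d.eval 1 ≠ 0) (h1' : d.eval (-1) ≠ 0) (hc : c.eval 1 = 0) :
    HasCoprimeSubset c d 5 := by
  classical
  have hXc : IsCoprime X c := by simpa using isCoprime_X_sub_C_iff.mpr h0
  have hXd : IsCoprime (1 + X) d := by
    simpa [add_comm] using isCoprime_X_sub_C_iff.mpr h1'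
  have hXcd : IsCoprime (X - 1) (c + d) := by
    have : (c + d).eval 1 ≠ 0 := by simpa [hc] using h1
    simpa using isCoprime_X_sub_C_iff.mpr this
  have hcdc : IsCoprime (c + d) c := by simpa [add_comm] using h.symm.add_mul_left_left 1
  have hcdd : IsCoprime (c + d) d := by simpa using h.add_mul_left_left 1
  have hcX : IsCoprime (c + X * d) X := hXc.symm.add_mul_left_left d
  have hcXc : IsCoprime (c + X * d) c := by
    simpa [add_comm] using (hXc.mul_left h.symm).add_mul_left_left 1
  have hcXd : IsCoprime (c + X * d) d := h.add_mul_right_left X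
  have h12 : IsCoprime ((1 + X) * c + X * d) (c + X * d) := by
    rw [show (1 + X) * c + X * d = X * c + (c + X * d) * 1 by ring]
    exact (hcX.mul_right hcXc).symm.add_mul_left_left 1
  have h13 : IsCoprime ((1 + X) * c + X * d) (c + d) := by
    rw [show (1 + X) * c + X * d = c + X * (c + d) by ring]
    exact hcdc.symm.add_mul_right_left X
  have h14 : IsCoprime ((1 + X) * c + X * d) d := (hXd.mul_left h).add_mul_right_left X
  have h15 : IsCoprime ((1 + X) * c + X * d) c := by
    simpa [add_comm] using (hXc.mul_left h.symm).add_mul_right_left (1 + X)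
  have h23 : IsCoprime (c + X * d) (c + d) := by
    rw [show c + X * d = (X - 1) * d + (c + d) * 1 by ring]
    exact (hXcd.symm.mul_right hcdd).symm.add_mul_left_left 1
  have hX1 : (X : Polynomial F) ≠ 1 := by
    simpa [sub_eq_zero] using X_sub_C_ne_zero (1 : F)
  let W : Finset (Polynomial F × Polynomial F) := {(1 + X, X), (1, X), (1, 1), (0, 1), (1, 0)}
  have hW : W.card = 5 := by simp [W, hX1]
  rw [← hW]
  have hdeg : ((1 : Polynomial F) + X).degree ≤ 1 := by
    rw [add_comm]; simpa using degree_linear_le_one (1 : F) 1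
  refine hf.hasCoprimeSubset W ?_ ?_
  · simp [W, hdeg]
  · have hpair : (↑W : Set (Polynomial F × Polynomial F)).Pairwise fun w w' =>
        IsCoprime (w.1 * c + w.2 * d) (w'.1 * c + w'.2 * d) := by
      have hsymm : Std.Symm fun w w' : Polynomial F × Polynomial F =>
          IsCoprime (w.1 * c + w.2 * d) (w'.1 * c + w'.2 * d) := ⟨fun _ _ e => e.symm⟩
      simp [W, Set.pairwise_insert_of_symm, h.symm, h12, h13, h14, h15, h23, hcXc, hcXd,
        hcdc, hcdd]
    exact fun w hw w' hw' hne => hpair hw hw' hne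

variable [Fintype F]

lemma hasCoprimeSubset_of_two_lt_card (hq : 2 < Fintype.card F) {c d : Polynomial F}
    (h : IsCoprime c d) (hf : LinearlyFree c d) (hd : d.eval 0 = 0) :
    HasCoprimeSubset c d (2 * Fintype.card F + 1) := by
  obtain ⟨L, hcard, hL⟩ := exists_affine_family hq fun a => -c.eval a / d.eval a
  refine (hasCoprimeSubset_of_affine_family h hf L ?_).of_le (Nat.succ_le_succ hcard)
  rintro l hl l' hl' hne a ⟨h1, h2⟩
  have hda : d.eval a ≠ 0 := by
    intro e
    exact not_eval_zero_of_isCoprime h e (by simpa [e] using h1)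
  have ha : a ≠ 0 := by
    rintro rfl
    exact hda hd
  refine hL l hl l' hl' hne a ha ⟨?_, ?_⟩ <;> rw [eq_div_iff hda]
  · linear_combination h1
  · linear_combination h2

lemma hasCoprimeSubset_of_card_eq_two (hq : Fintype.card F = 2) {c d : Polynomial F}
    (h : IsCoprime c d) (hf : LinearlyFree c d) (hd : d.eval 0 = 0) :
    HasCoprimeSubset c d (2 * Fintype.card F + 1) := by
  classical
  have hF : ∀ a : F, a ≠ 0 → a = 1 := by
    intro a ha
    by_contra ha1
    have h3 : ({0, 1, a} : Finset F).card = 3 := by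
      rw [Finset.card_eq_three]
      exact ⟨0, 1, a, zero_ne_one, Ne.symm ha, Ne.symm ha1, rfl⟩
    have := Finset.card_le_univ ({0, 1, a} : Finset F)
    omega
  by_cases hd1 : d.eval 1 = 0
  · have hda : ∀ a, d.eval a = 0 := fun a =>
      (em (a = 0)).elim (fun e => e ▸ hd) fun e => hF a e ▸ hd1
    refine (hasCoprimeSubset_of_affine_family h hf Finset.univ ?_).of_le (by simp [hq])
    rintro l - l' - - a ⟨h1, -⟩
    exact not_eval_zero_of_isCoprime h (hda a) (by simpa [hda a] using h1)
  · set k : F := -c.eval 1 / d.eval 1 with hk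
    refine HasCoprimeSubset.of_shear k ?_
    rw [hq]
    refine hasCoprimeSubset_five (h.add_mul_right_left _) (hf.shear k) ?_ hd1 ?_ ?_
    · simpa [hd] using not_eval_zero_of_isCoprime h hd
    · rwa [hF (-1) (neg_ne_zero.mpr one_ne_zero)]
    · simp [hk, hd1]

lemma hasCoprimeSubset_of_linearlyFree {c d : Polynomial F} (h : IsCoprime c d)
    (hf : LinearlyFree c d) : HasCoprimeSubset c d (2 * Fintype.card F + 1) := by
  have main : ∀ {c d : Polynomial F}, IsCoprime c d → LinearlyFree c d → d.eval 0 = 0 →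
      HasCoprimeSubset c d (2 * Fintype.card F + 1) := by
    intro c d h hf hd
    rcases (Nat.succ_le_of_lt (Fintype.one_lt_card (α := F))).lt_or_eq with hq | hq
    · exact hasCoprimeSubset_of_two_lt_card hq h hf hd
    · exact hasCoprimeSubset_of_card_eq_two hq.symm h hf hd
  by_cases hd : d.eval 0 = 0
  · exact main h hf hd
  · refine HasCoprimeSubset.of_shear (-c.eval 0 / d.eval 0) (HasCoprimeSubset.swap ?_)
    refine main (h.add_mul_right_left _).symm (hf.shear _).swap ?_
    simp [hd]

lemma finite_Sset (c d : Polynomial F) (m : ℕ) : (Sset F c d m).Finite := by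
  have hfin : {x : Polynomial F | x.degree ≤ (m : WithBot ℕ)}.Finite := by
    have : Finite (degreeLT F (m + 1)) := Finite.of_equiv _ (degreeLTEquiv F (m + 1)).symm.toEquiv
    refine (Set.toFinite (degreeLT F (m + 1) : Set (Polynomial F))).subset fun x hx => ?_
    rw [SetLike.mem_coe, mem_degreeLT]
    exact lt_of_le_of_lt hx (by exact_mod_cast Nat.lt_succ_self m)
  refine (hfin.image2 (fun x y => x * c + y * d) hfin).subset ?_
  rintro z ⟨x, y, hx, hy, rfl⟩
  exact ⟨x, hx, y, hy, rfl⟩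

lemma HasCoprimeSubset.le_tcd {c d : Polynomial F} {N : ℕ} (h : HasCoprimeSubset c d N) :
    N ≤ tcd F c d 1 := by
  obtain ⟨S, hS, hco, hN⟩ := h
  refine le_csSup_of_le ⟨(finite_Sset c d 1).toFinset.card, ?_⟩ ⟨S, hS, hco, rfl⟩ hN
  rintro _ ⟨T, hT, -, rfl⟩
  exact Finset.card_le_card fun z hz => (finite_Sset c d 1).mem_toFinset.mpr (hT hz)

end PairwiseCoprime

/-- For every integer `n ≥ 4`, one has `t(1, n) ≥ 2q + 1`. -/
theorem tmn_one_ge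
    (Fq : Type) [Field Fq] [Fintype Fq]
    (n : ℕ) (hn : 4 ≤ n) :
    ((2 * Fintype.card Fq + 1 : ℕ) : ℕ∞) ≤ tmn Fq 1 n := by
  refine le_sInf ?_
  rintro _ ⟨c, d, hcd, hlt, -, rfl⟩
  have h1 : 1 < max c.degree d.degree := lt_trans (by norm_num) hlt
  exact_mod_cast (hasCoprimeSubset_of_linearlyFree hcd (linearlyFree_of_degree_max hcd h1)).le_tcd

end SturmFF
end
end

section
/- Determination of harmonic cochains by their values on Γ: Let 𝔫 ∈ A₊. (1) If f ∈ H(𝔫) satisfies f(γ) = 0 for every γ ∈ GL₂(A), then f is identically zero. (2) If f ∈ H₀(𝔫) satisfies f(γ) = 0 for every γ = (a, b; c, d) ∈ GL₂(A) with deg(𝔫/gcd(c², 𝔫)) ≥ 2, then f is identically zero. (Here f(γ) is the value of f at the edge γ·e₀, where e₀ is the edge represented by the identity matrix.) -/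
open Polynomial Matrix

noncomputable section

namespace SturmFF

variable (Fq : Type) [Field Fq] [Fintype Fq]

section Reduction

variable {F : Type} [Field F]

/-- `ν_∞(x) ≥ n`. -/
def ValGE (n : ℤ) (x : Kinf F) : Prop := ∀ m : ℤ, m < n → x.coeff m = 0

lemma valGE_iff_addVal {n : ℤ} {x : Kinf F} :
    ValGE n x ↔ (n : WithTop ℤ) ≤ HahnSeries.addVal ℤ F x := by
  rw [HahnSeries.addVal_apply, HahnSeries.le_orderTop_iff_forall]
  simp [ValGE]

lemma valGE_iff_order {n : ℤ} {x : Kinf F} (hx : x ≠ 0) : ValGE n x ↔ n ≤ x.order := by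
  rw [valGE_iff_addVal, HahnSeries.addVal_apply_of_ne hx, WithTop.coe_le_coe]

lemma valGE_zero (n : ℤ) : ValGE n (0 : Kinf F) := fun _ _ => rfl

lemma ValGE.add {n : ℤ} {x y : Kinf F} (hx : ValGE n x) (hy : ValGE n y) : ValGE n (x + y) :=
  fun m hm => by simp [hx m hm, hy m hm]

lemma ValGE.neg {n : ℤ} {x : Kinf F} (hx : ValGE n x) : ValGE n (-x) :=
  fun m hm => by simp [hx m hm]

lemma ValGE.sub {n : ℤ} {x y : Kinf F} (hx : ValGE n x) (hy : ValGE n y) : ValGE n (x - y) :=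
  fun m hm => by simp [hx m hm, hy m hm]

lemma ValGE.mono {n k : ℤ} {x : Kinf F} (hx : ValGE n x) (h : k ≤ n) : ValGE k x :=
  fun m hm => hx m (hm.trans_le h)

lemma ValGE.mul {n k l : ℤ} {x y : Kinf F} (hx : ValGE n x) (hy : ValGE k y)
    (hl : l ≤ n + k) : ValGE l (x * y) := by
  rcases eq_or_ne x 0 with rfl | hx0
  · rw [zero_mul]; exact valGE_zero _
  rcases eq_or_ne y 0 with rfl | hy0
  · rw [mul_zero]; exact valGE_zero _
  rw [valGE_iff_order hx0] at hx
  rw [valGE_iff_order hy0] at hy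
  rw [valGE_iff_order (mul_ne_zero hx0 hy0), HahnSeries.order_mul hx0 hy0]
  lia

lemma valGE_single {n k : ℤ} (c : F) (h : n ≤ k) :
    ValGE n (HahnSeries.single k c : Kinf F) :=
  fun _ hm => HahnSeries.coeff_single_of_ne (by lia)

lemma valGE_one : ValGE 0 (1 : Kinf F) := valGE_single 1 le_rfl

lemma order_inv {x : Kinf F} (hx : x ≠ 0) : x⁻¹.order = -x.order := by
  have := HahnSeries.order_mul hx (inv_ne_zero hx)
  rw [mul_inv_cancel₀ hx, HahnSeries.order_one] at this
  lia

lemma coeff_zero_ne_zero {x : Kinf F} (hx : x ≠ 0) (h : x.order = 0) : x.coeff 0 ≠ 0 := by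
  rw [← h]
  exact HahnSeries.coeff_order_eq_zero.not.2 hx

lemma ne_zero_of_coeff_ne_zero {x : Kinf F} {n : ℤ} (h : x.coeff n ≠ 0) : x ≠ 0 := by
  rintro rfl
  exact h rfl

lemma order_of_coeff_zero_ne_zero {x : Kinf F} (hx : ValGE 0 x) (h : x.coeff 0 ≠ 0) :
    x.order = 0 :=
  le_antisymm (HahnSeries.order_le_of_coeff_ne_zero h)
    ((valGE_iff_order (ne_zero_of_coeff_ne_zero h)).1 hx)

lemma valGE_inv {x : Kinf F} (hx : ValGE 0 x) (h : x.coeff 0 ≠ 0) : ValGE 0 x⁻¹ := by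
  have h0 := ne_zero_of_coeff_ne_zero h
  rw [valGE_iff_order (inv_ne_zero h0), order_inv h0, order_of_coeff_zero_ne_zero hx h, neg_zero]

lemma thetaK_pow (r : ℕ) : thetaK F ^ r = HahnSeries.single (-r : ℤ) 1 := by
  simp [thetaK, HahnSeries.single_pow]

lemma thetaK_ne_zero : thetaK F ≠ 0 := by simp [thetaK]

lemma piInf_ne_zero : piInf F ≠ 0 := by simp [piInf]

lemma thetaK_mul_piInf : thetaK F * piInf F = 1 := by
  rw [thetaK, piInf, HahnSeries.single_mul_single]
  simp

lemma order_thetaK_pow (r : ℕ) : (thetaK F ^ r).order = -r := by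
  rw [thetaK_pow, HahnSeries.order_single one_ne_zero]

lemma polyToK_C (c : F) : polyToK F (C c) = HahnSeries.single 0 c := by
  simp only [polyToK, AlgHom.toRingHom_eq_coe, RingHom.coe_coe, aeval_C]
  exact LaurentSeries.algebraMap_apply F c

lemma polyToK_X : polyToK F X = thetaK F := by simp [polyToK]

lemma valGE_polyToK_C (c : F) : ValGE 0 (polyToK F (C c)) := by
  rw [polyToK_C]
  exact valGE_single c le_rfl

lemma exists_sub_constant (x : Kinf F) (hx : ValGE 0 x) :
    ∃ c : F, ValGE 1 (x - polyToK F (C c)) := by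
  refine ⟨x.coeff 0, fun m hm => ?_⟩
  rw [polyToK_C, HahnSeries.coeff_sub]
  rcases eq_or_ne m 0 with rfl | h
  · simp
  · rw [HahnSeries.coeff_single_of_ne h, hx m (by lia), sub_zero]

/-- Every element of `K_∞` is the sum of a polynomial and an element of the maximal ideal. -/
lemma exists_sub_poly (x : Kinf F) : ∃ a : F[X], ValGE 1 (x - polyToK F a) := by
  have key : ∀ (n : ℕ) (x : Kinf F), ValGE (1 - n) x →
      ∃ a : F[X], ValGE 1 (x - polyToK F a) := by
    intro n
    induction n with
    | zero => exact fun x hx => ⟨0, by simpa using hx⟩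
    | succ n ih =>
      intro x hx
      obtain ⟨a, ha⟩ := ih (x - polyToK F (C (x.coeff (-n)) * X ^ n)) (fun m hm => by
        rw [map_mul, map_pow, polyToK_C, polyToK_X, thetaK_pow, HahnSeries.single_mul_single,
          HahnSeries.coeff_sub, zero_add, mul_one]
        rcases eq_or_ne m (-n) with rfl | h
        · simp
        · rw [HahnSeries.coeff_single_of_ne h, hx m (by push_cast; lia), sub_zero])
      refine ⟨C (x.coeff (-n)) * X ^ n + a, ?_⟩
      rwa [map_add, ← sub_sub]
  rcases eq_or_ne x 0 with rfl | hx
  · exact ⟨0, by simpa using valGE_zero 1⟩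
  · exact key (1 - x.order).toNat x ((valGE_iff_order hx).2 (by lia))

lemma InGLO.mul {κ κ' : Matrix (Fin 2) (Fin 2) (Kinf F)} (h : InGLO F κ) (h' : InGLO F κ') :
    InGLO F (κ * κ') := by
  have det_valGE : ∀ {κ : Matrix (Fin 2) (Fin 2) (Kinf F)}, MatO F κ → ValGE 0 κ.det := by
    intro κ hκ
    rw [det_fin_two]
    exact (ValGE.mul (hκ 0 0) (hκ 1 1) le_rfl).sub (ValGE.mul (hκ 0 1) (hκ 1 0) le_rfl)
  refine ⟨fun i j => ?_, ?_⟩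
  · rw [mul_apply, Fin.sum_univ_two]
    exact (ValGE.mul (h.1 i 0) (h'.1 0 j) le_rfl).add (ValGE.mul (h.1 i 1) (h'.1 1 j) le_rfl)
  · have h0 := ne_zero_of_coeff_ne_zero h.2
    have h0' := ne_zero_of_coeff_ne_zero h'.2
    rw [det_mul]
    refine coeff_zero_ne_zero (mul_ne_zero h0 h0') ?_
    rw [HahnSeries.order_mul h0 h0', order_of_coeff_zero_ne_zero (det_valGE h.1) h.2,
      order_of_coeff_zero_ne_zero (det_valGE h'.1) h'.2, add_zero]

lemma inGLO_of {a b c d : Kinf F} (ha : ValGE 0 a) (hb : ValGE 0 b) (hc : ValGE 0 c)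
    (hd : ValGE 0 d) (h : (a * d - b * c).coeff 0 ≠ 0) : InGLO F !![a, b; c, d] := by
  refine ⟨fun i j => ?_, by rwa [det_fin_two_of]⟩
  fin_cases i <;> fin_cases j
  exacts [ha, hb, hc, hd]

lemma inGLO_swap : InGLO F !![0, 1; 1, 0] :=
  inGLO_of (valGE_zero 0) valGE_one valGE_one (valGE_zero 0) (by simp)

/-- The vertices `γ · diag(θ^r, 1)` of the Bruhat–Tits tree, `γ ∈ GL₂(A)`. -/
def Reducible (g : Matrix (Fin 2) (Fin 2) (Kinf F)) : Prop :=
  ∃ γ : Matrix (Fin 2) (Fin 2) F[X], IsUnit γ.det ∧ ∃ r : ℕ, ∃ z : Kinf F, z ≠ 0 ∧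
    ∃ κ, InGLO F κ ∧ g = γ.map (polyToK F) * Dmat F r * (z • 1) * κ

lemma Reducible.mul_left {g : Matrix (Fin 2) (Fin 2) (Kinf F)} (h : Reducible g)
    {γ : Matrix (Fin 2) (Fin 2) F[X]} (hγ : IsUnit γ.det) :
    Reducible (γ.map (polyToK F) * g) := by
  obtain ⟨γ', hγ', r, z, hz, κ, hκ, rfl⟩ := h
  refine ⟨γ * γ', by rw [det_mul]; exact hγ.mul hγ', r, z, hz, κ, hκ, ?_⟩
  rw [Matrix.map_mul]
  simp only [Matrix.mul_assoc]

lemma Reducible.smul_mul {g : Matrix (Fin 2) (Fin 2) (Kinf F)} (h : Reducible g)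
    {z : Kinf F} (hz : z ≠ 0) {κ : Matrix (Fin 2) (Fin 2) (Kinf F)} (hκ : InGLO F κ) :
    Reducible (z • (g * κ)) := by
  obtain ⟨γ', hγ', r, z', hz', κ', hκ', rfl⟩ := h
  refine ⟨γ', hγ', r, z * z', mul_ne_zero hz hz', κ' * κ, hκ'.mul hκ, ?_⟩
  simp [Matrix.mul_assoc, smul_smul]

lemma map_swap : (!![0, 1; 1, 0] : Matrix (Fin 2) (Fin 2) F[X]).map (polyToK F)
    = !![0, 1; 1, 0] := by
  ext i j; fin_cases i <;> fin_cases j <;> simp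

lemma map_unipotent (a : F[X]) : (!![1, a; 0, 1] : Matrix (Fin 2) (Fin 2) F[X]).map (polyToK F)
    = !![1, polyToK F a; 0, 1] := by
  ext i j; fin_cases i <;> fin_cases j <;> simp

lemma isUnit_det_swap : IsUnit (!![0, 1; 1, 0] : Matrix (Fin 2) (Fin 2) F[X]).det := by
  simp [det_fin_two_of]

lemma isUnit_det_unipotent (a : F[X]) :
    IsUnit (!![1, a; 0, 1] : Matrix (Fin 2) (Fin 2) F[X]).det := by
  simp [det_fin_two_of]

lemma reducible_of_order_nonpos {x u : Kinf F} (hx : x ≠ 0) (h : x.order ≤ 0)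
    (hu : ValGE 0 u) : Reducible !![x, u; 0, 1] := by
  obtain ⟨r, hr⟩ : ∃ r : ℕ, x.order = -r := ⟨(-x.order).toNat, by lia⟩
  have ht : thetaK F ^ r ≠ 0 := pow_ne_zero _ thetaK_ne_zero
  have hti : ValGE r (thetaK F ^ r)⁻¹ := by
    rw [valGE_iff_order (inv_ne_zero ht), order_inv ht, order_thetaK_pow, neg_neg]
  have hxt : ((thetaK F ^ r)⁻¹ * x) ≠ 0 := mul_ne_zero (inv_ne_zero ht) hx
  have ho : ((thetaK F ^ r)⁻¹ * x).order = 0 := by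
    rw [HahnSeries.order_mul (inv_ne_zero ht) hx, order_inv ht, order_thetaK_pow]
    lia
  refine ⟨1, by simp, r, 1, one_ne_zero, !![(thetaK F ^ r)⁻¹ * x, (thetaK F ^ r)⁻¹ * u; 0, 1],
    inGLO_of ?_ (hti.mul hu (by lia)) (valGE_zero 0) valGE_one ?_, ?_⟩
  · rw [valGE_iff_order hxt, ho]
  · simpa using coeff_zero_ne_zero hxt ho
  · simp [Dmat, ht]

/-- Reduction of `(a b; c d)` with `ν_∞(d) ≤ ν_∞(c)` to upper triangular form. -/
lemma reducible_of_upper {a b c d : Kinf F} (hd : d ≠ 0) (hc : ValGE d.order c)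
    (h : Reducible !![(a * d - b * c) / d ^ 2, b / d; 0, 1]) : Reducible !![a, b; c, d] := by
  have hκ : InGLO F !![1, 0; c * d⁻¹, 1] := by
    refine inGLO_of valGE_one (valGE_zero 0) (hc.mul (k := -d.order) ?_ (by lia)) valGE_one
      (by simp)
    rw [valGE_iff_order (inv_ne_zero hd), order_inv hd]
  convert h.smul_mul hd hκ using 1
  have h1 : d * ((a * d - b * c) / d ^ 2 + b / d * (c * d⁻¹)) = a := by
    field_simp
    ring
  have h2 : d * (c * d⁻¹) = c := by field_simp
  have h3 : d * (b / d) = b := by field_simp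
  simp [h1, h2, h3]

lemma reducible_upper {x : Kinf F} (hx : x ≠ 0) (u : Kinf F) : Reducible !![x, u; 0, 1] := by
  have key : ∀ (n : ℕ) (x u : Kinf F), x ≠ 0 → x.order ≤ n → Reducible !![x, u; 0, 1] := by
    intro n
    induction n with
    | zero =>
      intro x u hx hn
      obtain ⟨a, ha⟩ := exists_sub_poly u
      convert (reducible_of_order_nonpos hx hn (ha.mono zero_le_one)).mul_left
        (isUnit_det_unipotent a) using 1
      rw [map_unipotent]
      simp
    | succ n ih =>
      intro x u hx hn
      obtain ⟨a, ha⟩ := exists_sub_poly u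
      suffices h : Reducible !![x, u - polyToK F a; 0, 1] by
        convert h.mul_left (isUnit_det_unipotent a) using 1
        rw [map_unipotent]
        simp
      generalize u - polyToK F a = u at ha
      suffices h : Reducible !![0, 1; x, u] by
        convert h.mul_left isUnit_det_swap using 1
        rw [map_swap]
        simp
      by_cases hux : ValGE x.order u
      · have hxi : ValGE (-x.order) x⁻¹ := by
          rw [valGE_iff_order (inv_ne_zero hx), order_inv hx]
        have hκ : InGLO F !![0, 1; 1, x⁻¹ * u] :=
          inGLO_of (valGE_zero 0) valGE_one valGE_one (hxi.mul hux (by lia)) (by simp)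
        have hD : Reducible !![x⁻¹, 0; 0, 1] := by
          rcases le_total x.order 0 with h | h
          · have hw : Reducible !![x, 0; 0, 1] := reducible_of_order_nonpos hx h (valGE_zero 0)
            convert (hw.smul_mul (inv_ne_zero hx) inGLO_swap).mul_left isUnit_det_swap using 1
            rw [map_swap]
            ext i j
            fin_cases i <;> fin_cases j <;> simp [hx]
          · exact reducible_of_order_nonpos (inv_ne_zero hx) (by rw [order_inv hx]; lia)
              (valGE_zero 0)
        convert hD.smul_mul hx hκ using 1
        ext i j
        fin_cases i <;> fin_cases j <;> simp [hx]
      · have hu : u ≠ 0 := by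
          rintro rfl
          exact hux (valGE_zero _)
        rw [valGE_iff_order hu] at hux
        rw [valGE_iff_order hu] at ha
        refine reducible_of_upper hu ((valGE_iff_order hx).2 (by lia)) ?_
        have hu2 := pow_ne_zero 2 hu
        have h1 : (0 * u - 1 * x) ≠ 0 := by simpa using hx
        refine ih _ _ (div_ne_zero h1 hu2) ?_
        rw [div_eq_mul_inv, HahnSeries.order_mul h1 (inv_ne_zero hu2), order_inv hu2,
          HahnSeries.order_pow, zero_mul, one_mul, zero_sub, HahnSeries.order_neg, nsmul_eq_mul]
        push_cast at hn ⊢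
        lia
  exact key x.order.toNat x u hx (by lia)

/-- `GL₂(K_∞) = ⋃_r GL₂(A) · diag(θ^r, 1) · K_∞^× · GL₂(O_∞)`. -/
lemma reducible_of_det_ne_zero (g : Matrix (Fin 2) (Fin 2) (Kinf F)) (hg : g.det ≠ 0) :
    Reducible g := by
  have key : ∀ a b c d : Kinf F, a * d - b * c ≠ 0 → d ≠ 0 → ValGE d.order c →
      Reducible !![a, b; c, d] := fun a b c d h hd hc =>
    reducible_of_upper hd hc (reducible_upper (div_ne_zero h (pow_ne_zero 2 hd)) _)
  rw [eta_fin_two g] at hg ⊢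
  rw [det_fin_two_of] at hg
  generalize g 0 0 = a, g 0 1 = b, g 1 0 = c, g 1 1 = d at hg
  by_cases h : d ≠ 0 ∧ ValGE d.order c
  · exact key a b c d hg h.1 h.2
  · have hc : c ≠ 0 ∧ ValGE c.order d := by
      rcases eq_or_ne d 0 with rfl | hd
      · exact ⟨by rintro rfl; simp at hg, valGE_zero _⟩
      · have h' : ¬ ValGE d.order c := fun h' => h ⟨hd, h'⟩
        have hc : c ≠ 0 := by rintro rfl; exact h' (valGE_zero _)
        rw [valGE_iff_order hc] at h'
        exact ⟨hc, (valGE_iff_order hd).2 (by lia)⟩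
    convert (key b a d c (fun h => hg (by linear_combination -h)) hc.1 hc.2).smul_mul one_ne_zero
      inGLO_swap using 1
    simp

/-- The coset decomposition of `GL₂(O_∞)` modulo the Iwahori subgroup. -/
lemma InGLO.inIw_or {κ : Matrix (Fin 2) (Fin 2) (Kinf F)} (h : InGLO F κ) :
    InIw F κ ∨ ∃ ε : F, ∃ κ', InIw F κ' ∧
      κ = !![1, polyToK F (C ε); 0, 1] * !![0, 1; 1, 0] * κ' := by
  by_cases hc : (κ 1 0).coeff 0 = 0
  · refine Or.inl ⟨h, fun n hn => ?_⟩
    rcases eq_or_ne n 0 with rfl | h0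
    · exact hc
    · exact h.1 1 0 n (by lia)
  · right
    have hc0 := ne_zero_of_coeff_ne_zero hc
    obtain ⟨ε, hε⟩ := exists_sub_constant (κ 0 0 * (κ 1 0)⁻¹)
      (ValGE.mul (h.1 0 0) (valGE_inv (h.1 1 0) hc) le_rfl)
    have hU : InGLO F !![1, -polyToK F (C ε); 0, 1] :=
      inGLO_of valGE_one (valGE_polyToK_C ε).neg (valGE_zero 0) valGE_one (by simp)
    refine ⟨ε, !![0, 1; 1, 0] * (!![1, -polyToK F (C ε); 0, 1] * κ),
      ⟨inGLO_swap.mul (hU.mul h), ?_⟩, ?_⟩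
    · have h1 : ValGE 1 ((κ 0 0 * (κ 1 0)⁻¹ - polyToK F (C ε)) * κ 1 0) :=
        hε.mul (h.1 1 0) le_rfl
      convert h1 using 1
      simp only [mul_apply, Fin.sum_univ_two]
      simp only [ValGE, sub_mul, inv_mul_cancel_right₀ hc0]
      simp [sub_eq_add_neg]
    · have e : !![1, polyToK F (C ε); 0, 1] * !![0, 1; 1, 0] *
          (!![0, 1; 1, 0] * !![1, -polyToK F (C ε); 0, 1]) = 1 := by
        simp [one_fin_two]
      rw [← Matrix.mul_assoc !![0, 1; 1, 0], ← Matrix.mul_assoc, e, Matrix.one_mul]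

lemma inIw_one : InIw F 1 := by
  refine ⟨⟨?_, by simp⟩, fun n _ => by simp⟩
  rw [one_fin_two]
  exact (inGLO_of valGE_one (valGE_zero 0) (valGE_zero 0) valGE_one (by simp)).1

lemma inIw_unipotent {u : Kinf F} (hu : ValGE 0 u) : InIw F !![1, u; 0, 1] :=
  ⟨inGLO_of valGE_one hu (valGE_zero 0) valGE_one (by simp), fun n _ => by simp⟩

lemma det_Dmat_ne_zero (r : ℕ) : (Dmat F r).det ≠ 0 := by
  simp [Dmat, thetaK_ne_zero]

lemma det_map_ne_zero {γ : Matrix (Fin 2) (Fin 2) F[X]} (hγ : IsUnit γ.det) :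
    (γ.map (polyToK F)).det ≠ 0 := by
  have : (γ.map (polyToK F)).det = polyToK F γ.det := ((polyToK F).map_det γ).symm
  rw [this]
  exact (hγ.map (polyToK F)).ne_zero

lemma Dmat_succ_mul (r : ℕ) (ε : F) :
    Dmat F (r + 1) * !![1, polyToK F (C ε); 0, 1] * !![piInf F, 0; 0, 1]
      = (!![1, C ε * X ^ (r + 1); 0, 1] : Matrix (Fin 2) (Fin 2) F[X]).map (polyToK F)
        * Dmat F r := by
  rw [map_unipotent, map_mul, map_pow, polyToK_X]
  simp [Dmat, pow_succ, mul_assoc, thetaK_mul_piInf]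
  ring

lemma Dmat_zero : Dmat F 0 = 1 := by simp [Dmat, one_fin_two]

end Reduction

section HarmonicCochains

variable {Fq}
variable {𝔫 : Fq[X]} {f : Matrix (Fin 2) (Fin 2) (Kinf Fq) → ℂ}

lemma Harmonic.mul_right (hf : Harmonic Fq 𝔫 f) {g : Matrix (Fin 2) (Fin 2) (Kinf Fq)}
    (hg : g.det ≠ 0) {z : Kinf Fq} (hz : z ≠ 0) {κ : Matrix (Fin 2) (Fin 2) (Kinf Fq)}
    (hκ : InIw Fq κ) : f (g * (z • 1) * κ) = f g := by
  have := hf.1 g hg 1 ⟨by simp, by simp⟩ z hz κ hκ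
  rwa [Matrix.map_one _ (map_zero _) (map_one _), Matrix.one_mul] at this

lemma Harmonic.mul_left (hf : Harmonic Fq 𝔫 f) {g : Matrix (Fin 2) (Fin 2) (Kinf Fq)}
    (hg : g.det ≠ 0) {γ : Matrix (Fin 2) (Fin 2) Fq[X]} (hγ : InGamma0 Fq 𝔫 γ) :
    f (γ.map (polyToK Fq) * g) = f g := by
  simpa using hf.1 g hg γ hγ 1 one_ne_zero 1 inIw_one

/-- The edges `g` and `g · (0 1; 1 0)` are related by reversal and translation. -/
lemma Harmonic.mul_swap (hf : Harmonic Fq 𝔫 f) {g : Matrix (Fin 2) (Fin 2) (Kinf Fq)}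
    (hg : g.det ≠ 0) : f (g * !![0, 1; 1, 0]) = -f (g * !![piInf Fq, 0; 0, 1]) := by
  have h1 : (g * !![piInf Fq, 0; 0, 1]).det ≠ 0 := by simpa [det_mul] using ⟨hg, piInf_ne_zero⟩
  have h2 : (g * !![0, 1; 1, 0]).det ≠ 0 := by simpa [det_mul] using hg
  rw [← hf.2.1 _ h1, ← hf.mul_right h2 piInf_ne_zero inIw_one]
  have e : !![0, 1; 1, 0] * (piInf Fq • (1 : Matrix (Fin 2) (Fin 2) (Kinf Fq)))
      = !![piInf Fq, 0; 0, 1] * Jmat Fq := by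
    simp [Jmat]
  rw [Matrix.mul_one, Matrix.mul_assoc, e, ← Matrix.mul_assoc]

lemma Harmonic.eq_sum (hf : Harmonic Fq 𝔫 f) {g : Matrix (Fin 2) (Fin 2) (Kinf Fq)}
    (hg : g.det ≠ 0) :
    f g = ∑ ε : Fq, f (g * !![1, polyToK Fq (C ε); 0, 1] * !![piInf Fq, 0; 0, 1]) := by
  have h2 : (g * !![0, 1; 1, 0]).det ≠ 0 := by simpa [det_mul] using hg
  have h := hf.2.2 _ h2
  have h3 : g * !![0, 1; 1, 0] * !![0, 1; 1, 0] = g := by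
    rw [Matrix.mul_assoc]
    simp [← one_fin_two]
  rw [h3] at h
  have h4 : ∀ ε : Fq, f (g * !![0, 1; 1, 0] * !![1, 0; polyToK Fq (C ε), 1])
      = -f (g * !![1, polyToK Fq (C ε); 0, 1] * !![piInf Fq, 0; 0, 1]) := by
    intro ε
    rw [← hf.mul_swap (by simpa [det_mul] using hg)]
    simp [Matrix.mul_assoc]
  simp only [h4, Finset.sum_neg_distrib] at h
  linear_combination h

/-- The values on the edges `γ · diag(θ^(r+1), 1)` are sums of values at level `r`. -/
lemma Harmonic.eq_sum_Dmat (hf : Harmonic Fq 𝔫 f) {γ : Matrix (Fin 2) (Fin 2) Fq[X]}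
    (hγ : IsUnit γ.det) (r : ℕ) :
    f (γ.map (polyToK Fq) * Dmat Fq (r + 1))
      = ∑ ε : Fq, f ((γ * !![1, C ε * X ^ (r + 1); 0, 1]).map (polyToK Fq) * Dmat Fq r) := by
  rw [hf.eq_sum (by rw [det_mul]; exact mul_ne_zero (det_map_ne_zero hγ) (det_Dmat_ne_zero _))]
  refine Finset.sum_congr rfl fun ε _ => ?_
  rw [Matrix.map_mul, Matrix.mul_assoc, Matrix.mul_assoc, Matrix.mul_assoc (γ.map _),
    ← Matrix.mul_assoc (Dmat Fq (r + 1)), Dmat_succ_mul]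

lemma Harmonic.eq_zero_mul_Dmat (hf : Harmonic Fq 𝔫 f)
    (h : ∀ γ : Matrix (Fin 2) (Fin 2) Fq[X], IsUnit γ.det → f (γ.map (polyToK Fq)) = 0)
    (r : ℕ) {γ : Matrix (Fin 2) (Fin 2) Fq[X]} (hγ : IsUnit γ.det) :
    f (γ.map (polyToK Fq) * Dmat Fq r) = 0 := by
  induction r generalizing γ with
  | zero => simpa [Dmat_zero] using h γ hγ
  | succ r ih =>
    rw [hf.eq_sum_Dmat hγ]
    exact Finset.sum_eq_zero fun ε _ =>
      ih (by rw [det_mul]; exact hγ.mul (isUnit_det_unipotent _))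

lemma Harmonic.eq_zero_mul_Dmat_mul_swap (hf : Harmonic Fq 𝔫 f)
    (h : ∀ γ : Matrix (Fin 2) (Fin 2) Fq[X], IsUnit γ.det → f (γ.map (polyToK Fq)) = 0)
    (r : ℕ) {γ : Matrix (Fin 2) (Fin 2) Fq[X]} (hγ : IsUnit γ.det) (ε : Fq) :
    f (γ.map (polyToK Fq) * Dmat Fq r * !![1, polyToK Fq (C ε); 0, 1] * !![0, 1; 1, 0]) = 0 := by
  cases r with
  | zero =>
    have := h (γ * !![1, C ε; 0, 1] * !![0, 1; 1, 0]) (by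
      rw [det_mul, det_mul]
      exact (hγ.mul (isUnit_det_unipotent _)).mul isUnit_det_swap)
    rw [Matrix.map_mul, Matrix.map_mul, map_unipotent, map_swap] at this
    rwa [Dmat_zero, Matrix.mul_one]
  | succ r =>
    have e : γ.map (polyToK Fq) * Dmat Fq (r + 1) * !![1, polyToK Fq (C ε); 0, 1] *
        !![piInf Fq, 0; 0, 1] =
        (γ * !![1, C ε * X ^ (r + 1); 0, 1]).map (polyToK Fq) * Dmat Fq r := by
      rw [Matrix.map_mul, Matrix.mul_assoc (γ.map _) _ (Dmat Fq r), ← Dmat_succ_mul]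
      simp only [Matrix.mul_assoc]
    have hdet : (γ.map (polyToK Fq) * Dmat Fq (r + 1) *
        !![1, polyToK Fq (C ε); 0, 1]).det ≠ 0 := by
      rw [det_mul, det_mul, det_fin_two_of]
      exact mul_ne_zero (mul_ne_zero (det_map_ne_zero hγ) (det_Dmat_ne_zero _)) (by simp)
    refine (hf.mul_swap hdet).trans
      (neg_eq_zero.2 ((congrArg f e).trans (hf.eq_zero_mul_Dmat h r ?_)))
    rw [det_mul]
    exact hγ.mul (isUnit_det_unipotent _)

theorem Harmonic.eq_zero_of_Gamma (hf : Harmonic Fq 𝔫 f)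
    (h : ∀ γ : Matrix (Fin 2) (Fin 2) Fq[X], IsUnit γ.det → f (γ.map (polyToK Fq)) = 0)
    (g : Matrix (Fin 2) (Fin 2) (Kinf Fq)) (hg : g.det ≠ 0) : f g = 0 := by
  obtain ⟨γ, hγ, r, z, hz, κ, hκ, rfl⟩ := reducible_of_det_ne_zero g hg
  have hdet : (γ.map (polyToK Fq) * Dmat Fq r).det ≠ 0 := by
    rw [det_mul]
    exact mul_ne_zero (det_map_ne_zero hγ) (det_Dmat_ne_zero _)
  rcases hκ.inIw_or with hκ | ⟨ε, κ', hκ', rfl⟩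
  · rw [hf.mul_right hdet hz hκ, hf.eq_zero_mul_Dmat h r hγ]
  · have e : γ.map (polyToK Fq) * Dmat Fq r * (z • 1) *
        (!![1, polyToK Fq (C ε); 0, 1] * !![0, 1; 1, 0] * κ') =
        γ.map (polyToK Fq) * Dmat Fq r * !![1, polyToK Fq (C ε); 0, 1] * !![0, 1; 1, 0]
          * (z • 1) * κ' := by
      simp only [Matrix.mul_smul, Matrix.smul_mul, Matrix.mul_one, Matrix.mul_assoc]
    rw [e, hf.mul_right _ hz hκ', hf.eq_zero_mul_Dmat_mul_swap h r hγ]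
    rw [det_mul, det_mul, det_fin_two_of, det_fin_two_of]
    exact mul_ne_zero (mul_ne_zero hdet (by simp)) (by simp)

/-- Invariance under the stabilizer in `Γ₀(𝔫)` of the cusp attached to `γ`. -/
lemma Harmonic.mul_unipotent (hf : Harmonic Fq 𝔫 f) {γ : Matrix (Fin 2) (Fin 2) Fq[X]}
    (hγ : IsUnit γ.det) {x : Fq[X]} (hx : 𝔫 ∣ γ 1 0 ^ 2 * x)
    {g : Matrix (Fin 2) (Fin 2) (Kinf Fq)} (hg : g.det ≠ 0) :
    f ((γ * !![1, x; 0, 1]).map (polyToK Fq) * g) = f (γ.map (polyToK Fq) * g) := by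
  have hγ' : γ⁻¹ * γ = 1 := nonsing_inv_mul γ hγ
  have hmem : InGamma0 Fq 𝔫 (γ * !![1, x; 0, 1] * γ⁻¹) := by
    constructor
    · rw [det_mul, det_mul, det_nonsing_inv]
      exact (hγ.mul (isUnit_det_unipotent x)).mul (isUnit_ringInverse.2 hγ)
    · have e : (γ * !![1, x; 0, 1] * γ⁻¹) 1 0 = -(Ring.inverse γ.det * (γ 1 0 ^ 2 * x)) := by
        rw [inv_def, adjugate_fin_two]
        simp [mul_apply, Fin.sum_univ_two]
        ring
      rw [e]
      exact (hx.mul_left _).neg_right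
  rw [← hf.mul_left (g := γ.map (polyToK Fq) * g)
    (by rw [det_mul]; exact mul_ne_zero (det_map_ne_zero hγ) hg) hmem, ← Matrix.mul_assoc,
    ← Matrix.map_mul, Matrix.mul_assoc _ γ⁻¹, hγ', Matrix.mul_one]

/-- At a cusp of width at most one, the values grow geometrically towards the cusp. -/
lemma Harmonic.geometric_growth (hf : Harmonic Fq 𝔫 f) {γ : Matrix (Fin 2) (Fin 2) Fq[X]}
    (hγ : IsUnit γ.det) {m : Fq[X]} (hm : 𝔫 ∣ γ 1 0 ^ 2 * m) (hm0 : m ≠ 0)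
    (hdeg : m.natDegree ≤ 1) (r : ℕ) :
    f (γ.map (polyToK Fq) * Dmat Fq r) = Fintype.card Fq ^ r * f (γ.map (polyToK Fq)) := by
  induction r with
  | zero => simp [Dmat_zero]
  | succ r ih =>
    rw [hf.eq_sum_Dmat hγ, pow_succ' (Fintype.card Fq : ℂ), mul_assoc, ← ih, ← nsmul_eq_mul,
      ← Finset.card_univ]
    refine Finset.sum_eq_card_nsmul fun ε _ => ?_
    obtain ⟨c, hc⟩ : ∃ c, C c = C ε * X ^ (r + 1) % m := by
      rw [← natDegree_eq_zero]
      by_contra hne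
      have h1 := natDegree_lt_natDegree (p := C ε * X ^ (r + 1) % m) (q := m)
        (by rintro h; simp [h] at hne) (EuclideanDomain.mod_lt _ hm0)
      lia
    have hsplit : C ε * X ^ (r + 1) = m * (C ε * X ^ (r + 1) / m) + C c := by
      rw [hc, EuclideanDomain.div_add_mod]
    have ht : thetaK Fq ^ r ≠ 0 := pow_ne_zero _ thetaK_ne_zero
    have hU : γ * !![1, C ε * X ^ (r + 1); 0, 1]
        = γ * !![1, m * (C ε * X ^ (r + 1) / m); 0, 1] * !![1, C c; 0, 1] := by
      rw [Matrix.mul_assoc]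
      nth_rewrite 1 [hsplit]
      simp [add_comm]
    have hcD : !![1, polyToK Fq (C c); 0, 1] * Dmat Fq r
        = Dmat Fq r * !![1, (thetaK Fq ^ r)⁻¹ * polyToK Fq (C c); 0, 1] := by
      simp [Dmat, ht]
    have hI : InIw Fq !![1, (thetaK Fq ^ r)⁻¹ * polyToK Fq (C c); 0, 1] := by
      refine inIw_unipotent (ValGE.mul (n := r) ?_ (valGE_polyToK_C c) (by lia))
      rw [valGE_iff_order (inv_ne_zero ht), order_inv ht, order_thetaK_pow, neg_neg]
    have hdet : (Dmat Fq r * !![1, (thetaK Fq ^ r)⁻¹ * polyToK Fq (C c); 0, 1]).det ≠ 0 := by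
      rw [det_mul]
      exact mul_ne_zero (det_Dmat_ne_zero r) (by simp)
    rw [hU, Matrix.map_mul, map_unipotent, Matrix.mul_assoc, hcD,
      hf.mul_unipotent hγ ((hm.mul_right _).trans (by rw [mul_assoc])) hdet, ← Matrix.mul_assoc]
    have hg : (γ.map (polyToK Fq) * Dmat Fq r).det ≠ 0 := by
      rw [det_mul]
      exact mul_ne_zero (det_map_ne_zero hγ) (det_Dmat_ne_zero r)
    simpa using hf.mul_right hg one_ne_zero hI

lemma Cuspidal.finite_values (hf : Harmonic Fq 𝔫 f) (hc : Cuspidal Fq 𝔫 f) :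
    (f '' {g | g.det ≠ 0}).Finite := by
  obtain ⟨S, hS⟩ := hc
  refine ((S.finite_toSet.image f).insert 0).subset ?_
  rintro _ ⟨g, hg, rfl⟩
  by_cases h0 : f g = 0
  · exact Or.inl h0
  obtain ⟨s, hs, γ, hγ, z, hz, κ, hκ, rfl⟩ := hS g hg h0
  have hs0 : s.det ≠ 0 := by
    intro h
    simp [det_mul, h] at hg
  exact Or.inr ⟨s, hs, (hf.1 s hs0 γ hγ z hz κ hκ).symm⟩

theorem Cuspidal.eq_zero_of_Gamma (hf : Harmonic Fq 𝔫 f) (hc : Cuspidal Fq 𝔫 f)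
    {γ : Matrix (Fin 2) (Fin 2) Fq[X]}
    (hγ : IsUnit γ.det) {m : Fq[X]} (hm : 𝔫 ∣ γ 1 0 ^ 2 * m) (hm0 : m ≠ 0)
    (hdeg : m.natDegree ≤ 1) : f (γ.map (polyToK Fq)) = 0 := by
  by_contra h0
  have hq : 2 ≤ Fintype.card Fq := Fintype.one_lt_card
  have hinj : Function.Injective fun r : ℕ => f (γ.map (polyToK Fq) * Dmat Fq r) := by
    intro r s hrs
    simp only [hf.geometric_growth hγ hm hm0 hdeg] at hrs
    have := mul_right_cancel₀ h0 hrs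
    exact Nat.pow_right_injective hq (by exact_mod_cast this)
  refine Set.infinite_range_of_injective hinj ((hc.finite_values hf).subset ?_)
  rintro _ ⟨r, rfl⟩
  refine ⟨_, ?_, rfl⟩
  rw [Set.mem_ofPred_eq, det_mul]
  exact mul_ne_zero (det_map_ne_zero hγ) (det_Dmat_ne_zero r)

end HarmonicCochains

open Classical in
/-- **Determination of harmonic cochains by their values on `Γ = GL₂(A)`**:
(1) any `f ∈ H(𝔫)` vanishing on all edges `γ·e₀`, `γ ∈ GL₂(A)`, is identically zero;
(2) any cuspidal `f ∈ H₀(𝔫)` vanishing on all `γ·e₀` with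
`deg (𝔫 / gcd(c², 𝔫)) ≥ 2` (where `c = γ 1 0`) is identically zero. -/
theorem determined_by_values_on_Gamma
    (Fq : Type) [Field Fq] [Fintype Fq]
    (𝔫 : Polynomial Fq) (h𝔫 : 𝔫.Monic)
    (f : Matrix (Fin 2) (Fin 2) (Kinf Fq) → ℂ) (hf : Harmonic Fq 𝔫 f) :
    ((∀ γ : Matrix (Fin 2) (Fin 2) (Polynomial Fq), IsUnit γ.det →
        f (γ.map (polyToK Fq)) = 0) →
      ∀ g : Matrix (Fin 2) (Fin 2) (Kinf Fq), g.det ≠ 0 → f g = 0)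
    ∧ (Cuspidal Fq 𝔫 f →
      (∀ γ : Matrix (Fin 2) (Fin 2) (Polynomial Fq), IsUnit γ.det →
          2 ≤ (𝔫 / EuclideanDomain.gcd ((γ 1 0) ^ 2) 𝔫).natDegree →
          f (γ.map (polyToK Fq)) = 0) →
      ∀ g : Matrix (Fin 2) (Fin 2) (Kinf Fq), g.det ≠ 0 → f g = 0) := by
  refine ⟨hf.eq_zero_of_Gamma, fun hc h => hf.eq_zero_of_Gamma fun γ hγ => ?_⟩
  have hdvd : EuclideanDomain.gcd (γ 1 0 ^ 2) 𝔫 ∣ 𝔫 := EuclideanDomain.gcd_dvd_right _ _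
  have hgm : EuclideanDomain.gcd (γ 1 0 ^ 2) 𝔫 * (𝔫 / EuclideanDomain.gcd (γ 1 0 ^ 2) 𝔫) = 𝔫 :=
    EuclideanDomain.mul_div_cancel' (fun h0 => h𝔫.ne_zero (zero_dvd_iff.1 (h0 ▸ hdvd))) hdvd
  by_cases hdeg : 2 ≤ (𝔫 / EuclideanDomain.gcd (γ 1 0 ^ 2) 𝔫).natDegree
  · exact h γ hγ hdeg
  · refine hc.eq_zero_of_Gamma hf hγ (m := 𝔫 / EuclideanDomain.gcd (γ 1 0 ^ 2) 𝔫) ?_ ?_ (by lia)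
    · nth_rewrite 1 [← hgm]
      exact mul_dvd_mul_right (EuclideanDomain.gcd_dvd_left _ _) _
    · intro h0
      rw [h0, mul_zero] at hgm
      exact h𝔫.ne_zero hgm.symm
end SturmFF
end
end
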